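/- If T is a cluster tilting object in the cluster category CC_Q, then the maximal direct summand T̄ of T lying in rep Q is a support tilting module. Conversely, every support tilting module V in rep Q extends to a cluster tilting object of CC_Q by adding shifted projectives P_i[1] in exactly one way, namely by adding the shifted projectives corresponding to the vertices not in the support of V. -/

import Mathlib

open CategoryTheory CategoryTheory.Limits ZeroObject

attribute [local instance] CategoryTheory.Abelian.hasFiniteBiproducts

noncomputable section

namespace NCPaper

/-- A finite quiver without oriented cycles. -/
structure FinQuiver : Type 1 where
  V : Type
  [quiver : Quiver.{0} V]
  [fintypeV : Fintype V]
  [fintypeArr : ∀ a b : V, Fintype (a ⟶ b)]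
  acyclic : ∀ (v : V) (p : Quiver.Path v v), p = Quiver.Path.nil

attribute [instance] FinQuiver.quiver FinQuiver.fintypeV FinQuiver.fintypeArr

variable (k : Type) [Field k] (Q : FinQuiver)

/-- The ambient abelian category of all `k`-linear representations of `Q`;
finite-dimensional representations are singled out by the predicate `FinDim`. -/
abbrev RepC : Type 1 := Paths Q.V ⥤ ModuleCat.{0} k

variable {k Q}

/-- `M` is a finite-dimensional representation, i.e. an object of `rep Q`. -/
def FinDim (M : RepC k Q) : Prop :=
  ∀ v : Q.V, FiniteDimensional k (M.obj ((Paths.of Q.V).obj v))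

section Cat

variable {C : Type*} [Category C] [Abelian C]

/-- `X` is a direct summand of `A`. -/
def IsSummand (X A : C) : Prop := ∃ (i : X ⟶ A) (r : A ⟶ X), i ≫ r = 𝟙 X

/-- The additive closure of a set of objects: direct summands of finite direct sums. -/
def addSet (S : Set C) : Set C :=
  { X | ∃ (n : ℕ) (f : Fin n → C), (∀ i, f i ∈ S) ∧ IsSummand X (⨁ f) }

/-- `Gen S`: all quotients of objects of the additive closure of `S`. -/
def gen (S : Set C) : Set C := { X | ∃ A ∈ addSet S, ∃ p : A ⟶ X, Epi p }

/-- All morphisms from `A` to `B` vanish. -/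
def HomZero (A B : C) : Prop := ∀ f : A ⟶ B, f = 0

/-- `Ext¹(A, B) = 0`, expressed by the splitting of all short exact sequences
`0 ⟶ B ⟶ E ⟶ A ⟶ 0`. -/
def Ext1Zero (A B : C) : Prop :=
  ∀ (E : C) (i : B ⟶ E) (p : E ⟶ A) (w : i ≫ p = 0),
    (ShortComplex.mk i p w).ShortExact → ∃ r : E ⟶ B, i ≫ r = 𝟙 B

/-- An indecomposable object. -/
def Indec (X : C) : Prop :=
  ¬ IsZero X ∧ ∀ (A B : C), (X ≅ A ⊞ B) → IsZero A ∨ IsZero B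

/-- A torsion class: a full subcategory (identified with its set of objects) closed under
direct sums, direct summands, quotients and extensions. -/
structure IsTorsionClass (T : Set C) : Prop where
  zero_mem : (0 : C) ∈ T
  sum_mem : ∀ X ∈ T, ∀ Y ∈ T, (X ⊞ Y : C) ∈ T
  summand_mem : ∀ X ∈ T, ∀ Y : C, IsSummand Y X → Y ∈ T
  quot_mem : ∀ X ∈ T, ∀ (Y : C) (p : X ⟶ Y), Epi p → Y ∈ T
  ext_mem : ∀ S : ShortComplex C, S.ShortExact → S.X₁ ∈ T → S.X₃ ∈ T → S.X₂ ∈ T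

/-- A wide subcategory: a full subcategory (closed under direct sums and summands)
which is exact abelian (closed under kernels and cokernels) and closed under extensions. -/
structure IsWide (A : Set C) : Prop where
  zero_mem : (0 : C) ∈ A
  sum_mem : ∀ X ∈ A, ∀ Y ∈ A, (X ⊞ Y : C) ∈ A
  summand_mem : ∀ X ∈ A, ∀ Y : C, IsSummand Y X → Y ∈ A
  ker_mem : ∀ X ∈ A, ∀ Y ∈ A, ∀ f : X ⟶ Y, (kernel f : C) ∈ A
  coker_mem : ∀ X ∈ A, ∀ Y ∈ A, ∀ f : X ⟶ Y, (cokernel f : C) ∈ A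
  ext_mem : ∀ S : ShortComplex C, S.ShortExact → S.X₁ ∈ A → S.X₃ ∈ A → S.X₂ ∈ A

/-- `P` is split projective in the subcategory `T`: every epimorphism onto `P`
from an object of `T` splits. -/
def SplitProjIn (T : Set C) (P : C) : Prop :=
  P ∈ T ∧ ∀ X ∈ T, ∀ p : X ⟶ P, Epi p → ∃ s : P ⟶ X, s ≫ p = 𝟙 P

/-- `P` is Ext-projective in the subcategory `T`. -/
def ExtProjIn (T : Set C) (P : C) : Prop := P ∈ T ∧ ∀ X ∈ T, Ext1Zero P X

/-- The subcategory `a(T)` associated to a torsion class `T`. -/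
def aSet (T : Set C) : Set C :=
  { B | B ∈ T ∧ ∀ Y ∈ T, ∀ g : Y ⟶ B, (kernel g : C) ∈ T }

/-- A subcategory is finitely generated if it is generated by a single object of it. -/
def IsFinGen (T : Set C) : Prop := ∃ U ∈ T, T ⊆ gen {U}

/-- `U` is a generator of the subcategory `T`. -/
def IsGenerator (T : Set C) (U : C) : Prop := U ∈ T ∧ T ⊆ gen {U}

/-- `X` is a subquotient of `M`. -/
def IsSubquotient (X M : C) : Prop := ∃ (N : C) (i : N ⟶ M) (p : N ⟶ X), Mono i ∧ Epi p

/-- The support of `M` is contained in the support of `C0`: every simple subquotient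
(composition factor) of `M` is a composition factor of `C0`. -/
def SuppLE (M C0 : C) : Prop := ∀ S : C, Simple S → IsSubquotient S M → IsSubquotient S C0

/-- A partial tilting object of a hereditary category. -/
def IsPartialTilting (T : C) : Prop := Ext1Zero T T

/-- `T` is a tilting object of the full subcategory `A`: it is self-orthogonal and every
(split) projective object of `A` admits a coresolution `0 ⟶ P ⟶ T' ⟶ T'' ⟶ 0` with
`T', T'' ∈ add T`. For `A` the subcategory of representations supported on `supp T`,
this says exactly that `T` is a tilting `kQ/ann T`-module. -/
def TiltingIn (A : Set C) (T : C) : Prop :=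
  T ∈ A ∧ Ext1Zero T T ∧
    ∀ P : C, SplitProjIn A P →
      ∃ (T' T'' : C) (_ : T' ∈ addSet {T}) (_ : T'' ∈ addSet {T})
        (i : P ⟶ T') (p : T' ⟶ T'') (w : i ≫ p = 0),
        (ShortComplex.mk i p w).ShortExact


/-- `U` is the direct sum of one representative of each isomorphism class of
indecomposable Ext-projective objects of `T`. -/
def IsExtProjSum (T : Set C) (U : C) : Prop :=
  ∃ (n : ℕ) (f : Fin n → C),
    (∀ i, Indec (f i) ∧ ExtProjIn T (f i)) ∧
    (∀ i j, Nonempty (f i ≅ f j) → i = j) ∧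
    (∀ P : C, Indec P → ExtProjIn T P → ∃ i, Nonempty (P ≅ f i)) ∧
    Nonempty (U ≅ ⨁ f)

/-- A basic object: a direct sum of pairwise non-isomorphic indecomposables. -/
def IsBasic (U : C) : Prop :=
  ∃ (n : ℕ) (f : Fin n → C), (∀ i, Indec (f i)) ∧
    (∀ i j, Nonempty (f i ≅ f j) → i = j) ∧ Nonempty (U ≅ ⨁ f)

end Cat

/-- A support tilting object of `rep Q`: partial tilting, and tilting as a
`kQ/ann T`-module, i.e. tilting in the subcategory of all finite-dimensional
representations supported on the support of `T`. -/
def IsSupportTilting {k : Type} [Field k] {Q : FinQuiver} (T : RepC k Q) : Prop :=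
  IsPartialTilting T ∧ TiltingIn { M : RepC k Q | FinDim M ∧ SuppLE M T } T

section Comb

/-- The dimension vector of a representation. -/
def dimVec {k : Type} [Field k] {Q : FinQuiver} (M : RepC k Q) : Q.V → ℤ :=
  fun v => (Module.finrank k (M.obj ((Paths.of Q.V).obj v)) : ℤ)

/-- The Euler form of the quiver `Q`. -/
def euler (Q : FinQuiver) {R : Type} [CommRing R] (α β : Q.V → R) : R :=
  (∑ v : Q.V, α v * β v) - ∑ a : (Σ x : Q.V, Σ y : Q.V, x ⟶ y), α a.1 * β a.2.1

/-- The symmetrized Euler form of the quiver `Q`. -/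
def symEuler (Q : FinQuiver) {R : Type} [CommRing R] (α β : Q.V → R) : R :=
  euler Q α β + euler Q β α

/-- The reflection in the vector `v`: `s_v(w) = w - (v, w)·v`. -/
def reflV (Q : FinQuiver) (v : Q.V → ℤ) : (Q.V → ℤ) → (Q.V → ℤ) :=
  fun w => w - symEuler Q v w • v

/-- The composition (product, written from left to right) of a finite sequence of
linear transformations. -/
def comps (Q : FinQuiver) {m : ℕ} (g : Fin m → ((Q.V → ℤ) → (Q.V → ℤ))) :
    (Q.V → ℤ) → (Q.V → ℤ) :=
  (List.ofFn g).foldr (· ∘ ·) id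

open scoped Classical in
/-- The simple root at a vertex. -/
def simRoot (Q : FinQuiver) (v : Q.V) : Q.V → ℤ := fun w => if w = v then 1 else 0

/-- The simple reflection at a vertex. -/
def sref (Q : FinQuiver) (v : Q.V) : (Q.V → ℤ) → (Q.V → ℤ) := reflV Q (simRoot Q v)

/-- An enumeration of the vertices is compatible with the arrows of `Q` if sources
of arrows come before targets. -/
def OrdCompatible (Q : FinQuiver) (ord : Fin (Fintype.card Q.V) ≃ Q.V) : Prop :=
  ∀ (x y : Q.V), (x ⟶ y) → ord.symm x < ord.symm y

/-- The Coxeter element `cox(Q)`: the product of the simple reflections from left to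
right in an order compatible with the arrows of `Q`. -/
def coxeter (Q : FinQuiver) (ord : Fin (Fintype.card Q.V) ≃ Q.V) :
    (Q.V → ℤ) → (Q.V → ℤ) :=
  comps Q fun i => sref Q (ord i)

/-- The product of the simple reflections indexed by a word (a list of vertices). -/
def wordProd (Q : FinQuiver) (l : List Q.V) : (Q.V → ℤ) → (Q.V → ℤ) :=
  (l.map (sref Q)).foldr (· ∘ ·) id

/-- Membership in the Coxeter group `W` (realized faithfully on the root lattice). -/
def InW (Q : FinQuiver) (w : (Q.V → ℤ) → (Q.V → ℤ)) : Prop :=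
  ∃ l : List Q.V, w = wordProd Q l

/-- The reflections of `W`: the conjugates of the simple reflections. -/
def IsRefl (Q : FinQuiver) (t : (Q.V → ℤ) → (Q.V → ℤ)) : Prop :=
  ∃ (l : List Q.V) (i : Q.V), t = wordProd Q l ∘ sref Q i ∘ wordProd Q l.reverse

/-- The absolute length: the least length of an expression as a product of reflections. -/
def ellT (Q : FinQuiver) (w : (Q.V → ℤ) → (Q.V → ℤ)) : ℕ :=
  sInf { m | ∃ f : Fin m → ((Q.V → ℤ) → (Q.V → ℤ)), (∀ i, IsRefl Q (f i)) ∧ w = comps Q f }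

/-- The absolute order on `W`. -/
def absLe (Q : FinQuiver) : ((Q.V → ℤ) → (Q.V → ℤ)) → ((Q.V → ℤ) → (Q.V → ℤ)) → Prop :=
  Relation.ReflTransGen fun u v => ∃ t, IsRefl Q t ∧ v = u ∘ t ∧ ellT Q v = ellT Q u + 1

/-- The noncrossing partitions `NC_Q`: the interval `[e, cox(Q)]` in absolute order. -/
def NCSet (Q : FinQuiver) (ord : Fin (Fintype.card Q.V) ≃ Q.V) :
    Set ((Q.V → ℤ) → (Q.V → ℤ)) :=
  { w | InW Q w ∧ absLe Q w (coxeter Q ord) }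

/-- `Q` is of finite (Dynkin) type: the symmetrized Euler form is positive definite. -/
def FiniteType (Q : FinQuiver) : Prop :=
  ∀ α : Q.V → ℚ, α ≠ 0 → 0 < symEuler Q α α

/-- `Q` is of affine (extended Dynkin) type: the symmetrized Euler form is positive
semidefinite with nontrivial radical. -/
def AffineType (Q : FinQuiver) : Prop :=
  (∀ α : Q.V → ℚ, 0 ≤ symEuler Q α α) ∧ ∃ α : Q.V → ℚ, α ≠ 0 ∧ symEuler Q α α = 0

end Comb

section ClusterCategory

variable {k : Type} [Field k] {Q : FinQuiver}

/-- An object of the cluster category `CC_Q = D^b(rep Q)/τ⁻¹[1]`, presented through a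
fundamental domain: a representation of `Q` (the summands lying in `rep Q`) together
with a set of vertices recording the shifted projective summands `P_i[1]`. -/
structure CCObj (k : Type) [Field k] (Q : FinQuiver) : Type 1 where
  r : RepC k Q
  sh : Set Q.V

/-- `P` is (a representative of) the indecomposable projective representation at the
vertex `v`: it is indecomposable projective and its simple top is concentrated
at `v`. -/
def IsProjAt (P : RepC k Q) (v : Q.V) : Prop :=
  FinDim P ∧ Indec P ∧ Projective P ∧
    ∀ S : RepC k Q, FinDim S → Simple S →
      ((∃ f : P ⟶ S, f ≠ 0) ↔ ¬ IsZero (S.obj ((Paths.of Q.V).obj v)))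

/-- Vanishing of `Ext¹` in the cluster category, described on the fundamental domain:
for `X, Y ∈ rep Q`, `Ext¹_CC(X,Y) = 0` iff `Ext¹(X,Y) = 0 = Ext¹(Y,X)`;
`Ext¹_CC(X, P_i[1]) = 0` iff `Hom(P_i, X) = 0`; and shifted projectives have no
self-extensions.  (`P` is the family of indecomposable projectives.) -/
def CCExt1Zero (P : Q.V → RepC k Q) (X Y : CCObj k Q) : Prop :=
  Ext1Zero X.r Y.r ∧ Ext1Zero Y.r X.r ∧
    (∀ i ∈ X.sh, HomZero (P i) Y.r) ∧ ∀ j ∈ Y.sh, HomZero (P j) X.r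

/-- `X` is a cluster tilting object of `CC_Q`: it has no self-extensions in `CC_Q` and
every indecomposable of `CC_Q` (an indecomposable representation, or a shifted
projective `P_j[1]`) having no extensions with `X` is a direct summand of `X`. -/
def IsClusterTilting (P : Q.V → RepC k Q) (X : CCObj k Q) : Prop :=
  CCExt1Zero P X X ∧
  (∀ U : RepC k Q, FinDim U → Indec U → Ext1Zero X.r U → Ext1Zero U X.r →
      (∀ i ∈ X.sh, HomZero (P i) U) → IsSummand U X.r) ∧
  (∀ j : Q.V, HomZero (P j) X.r → j ∈ X.sh)

end ClusterCategory

section Helpers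

section Gen

variable {C : Type*} [Category C] [Abelian C]

/-- pushing out a short exact sequence -/
lemma pushout_ses {K G A B : C} (i : K ⟶ G) (p : G ⟶ A) (w : i ≫ p = 0)
    (h : (ShortComplex.mk i p w).ShortExact) (j : K ⟶ B) :
    ∃ (E : C) (a : B ⟶ E) (b : E ⟶ A) (g : G ⟶ E) (w : a ≫ b = 0),
      (ShortComplex.mk a b w).ShortExact ∧ i ≫ g = j ≫ a := by
  have : Mono i := h.mono_f
  have : Epi p := h.epi_g
  have hw : i ≫ p = j ≫ (0 : B ⟶ A) := by rw [w, comp_zero]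
  have e1 := pushout.inl_desc p (0 : B ⟶ A) hw
  have e2 := pushout.inr_desc p (0 : B ⟶ A) hw
  have hepi : Epi (pushout.desc p (0 : B ⟶ A) hw) := epi_of_epi_fac e1
  refine ⟨_, pushout.inr i j, pushout.desc p 0 hw, pushout.inl i j, e2, ?_, pushout.condition⟩
  refine ShortComplex.ShortExact.mk' ?_ (by dsimp; infer_instance) hepi
  apply ShortComplex.exact_of_g_is_cokernel
  refine CokernelCofork.IsColimit.ofπ' _ _ (fun {Z} x hx => ?_)
  dsimp at hx x
  have h1 : i ≫ (pushout.inl i j ≫ x) = 0 := by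
    rw [← Category.assoc, pushout.condition, Category.assoc, hx, comp_zero]
  have h2 : p ≫ h.exact.desc (pushout.inl i j ≫ x) h1 = _ := h.exact.g_desc _ h1
  refine ⟨h.exact.desc (pushout.inl i j ≫ x) h1, ?_⟩
  dsimp
  apply pushout.hom_ext
  · rw [reassoc_of% e1, h2]
  · rw [reassoc_of% e2, zero_comp, hx]

lemma ext_of_extends {K E A B : C} (hAB : Ext1Zero A B) (i : K ⟶ E) (p : E ⟶ A) (w : i ≫ p = 0)
    (h : (ShortComplex.mk i p w).ShortExact) (j : K ⟶ B) : ∃ s : E ⟶ B, i ≫ s = j := by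
  obtain ⟨F, a, b, g, w', hs, hg⟩ := pushout_ses i p w h j
  obtain ⟨r, hr⟩ := hAB _ _ _ _ hs
  exact ⟨g ≫ r, by rw [reassoc_of% hg, hr, Category.comp_id]⟩

lemma section_of_retr {B E A : C} (i : B ⟶ E) (p : E ⟶ A) (w : i ≫ p = 0)
    (h : (ShortComplex.mk i p w).ShortExact) (r : E ⟶ B) (hr : i ≫ r = 𝟙 B) :
    ∃ s : A ⟶ E, s ≫ p = 𝟙 A := by
  have : Mono i := h.mono_f
  have : Epi p := h.epi_g
  have h1 : i ≫ (𝟙 E - r ≫ i) = 0 := by simp [reassoc_of% hr]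
  refine ⟨h.exact.desc _ h1, ?_⟩
  have := h.exact.g_desc _ h1
  dsimp at this
  rw [← cancel_epi p, reassoc_of% this]
  simp [w]

lemma retr_of_section {B E A : C} (i : B ⟶ E) (p : E ⟶ A) (w : i ≫ p = 0)
    (h : (ShortComplex.mk i p w).ShortExact) (s : A ⟶ E) (hs : s ≫ p = 𝟙 A) :
    ∃ r : E ⟶ B, i ≫ r = 𝟙 B := by
  have : Mono i := h.mono_f
  have h1 : (𝟙 E - p ≫ s) ≫ p = 0 := by simp [hs]
  refine ⟨h.exact.lift _ h1, ?_⟩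
  have := h.exact.lift_f _ h1
  dsimp at this
  rw [← cancel_mono i, Category.assoc, this]
  simp [reassoc_of% w]

/-- pulling back a short exact sequence -/
lemma pullback_ses {B E A M : C} (i : B ⟶ E) (p : E ⟶ A) (w : i ≫ p = 0)
    (h : (ShortComplex.mk i p w).ShortExact) (f : M ⟶ A) :
    ∃ (a : B ⟶ pullback p f) (w : a ≫ pullback.snd p f = 0),
      (ShortComplex.mk a (pullback.snd p f) w).ShortExact ∧ a ≫ pullback.fst p f = i := by
  have : Mono i := h.mono_f
  have : Epi p := h.epi_g
  have hw : i ≫ p = (0 : B ⟶ M) ≫ f := by rw [w, zero_comp]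
  have e1 := pullback.lift_fst i (0 : B ⟶ M) hw
  have e2 := pullback.lift_snd i (0 : B ⟶ M) hw
  have hmono : Mono (pullback.lift i (0 : B ⟶ M) hw) := mono_of_mono_fac e1
  refine ⟨_, e2, ?_, e1⟩
  refine ShortComplex.ShortExact.mk' ?_ hmono (by dsimp; infer_instance)
  apply ShortComplex.exact_of_f_is_kernel
  refine KernelFork.IsLimit.ofι' _ _ (fun {Z} x hx => ?_)
  dsimp at hx x
  have h1 : (x ≫ pullback.fst p f) ≫ p = 0 := by
    rw [Category.assoc, pullback.condition, reassoc_of% hx, zero_comp]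
  refine ⟨h.exact.lift _ h1, ?_⟩
  have h2 : h.exact.lift _ h1 ≫ i = _ := h.exact.lift_f _ h1
  dsimp
  apply pullback.hom_ext
  · rw [Category.assoc, e1, h2]
  · rw [Category.assoc, e2, comp_zero, hx]

lemma ext_lifts {B E A M : C} (hMB : Ext1Zero M B) (i : B ⟶ E) (p : E ⟶ A) (w : i ≫ p = 0)
    (h : (ShortComplex.mk i p w).ShortExact) (f : M ⟶ A) : ∃ s : M ⟶ E, s ≫ p = f := by
  obtain ⟨a, wa, hs, ha⟩ := pullback_ses i p w h f
  obtain ⟨r, hr⟩ := hMB _ _ _ _ hs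
  obtain ⟨s, hs'⟩ := section_of_retr _ _ _ hs r hr
  exact ⟨s ≫ pullback.fst p f, by rw [Category.assoc, pullback.condition, reassoc_of% hs']⟩

lemma ext_middle {M E N Y : C} (i : M ⟶ E) (p : E ⟶ N) (w : i ≫ p = 0)
    (h : (ShortComplex.mk i p w).ShortExact) (h1 : Ext1Zero M Y) (h2 : Ext1Zero N Y) :
    Ext1Zero E Y := by
  intro F a b wab hab
  have : Mono a := hab.mono_f
  have : Epi b := hab.epi_g
  have : Mono i := h.mono_f
  have : Epi p := h.epi_g
  obtain ⟨a', wa, hsa, ha⟩ := pullback_ses a b wab hab i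
  obtain ⟨r, hr⟩ := h1 _ _ _ _ hsa
  have w2 : pullback.fst b i ≫ (b ≫ p) = 0 := by
    rw [← Category.assoc, pullback.condition, Category.assoc, w, comp_zero]
  have hs : (ShortComplex.mk (pullback.fst b i) (b ≫ p) w2).ShortExact := by
    refine ShortComplex.ShortExact.mk' ?_ (by dsimp; infer_instance) (by dsimp; infer_instance)
    apply ShortComplex.exact_of_f_is_kernel
    refine KernelFork.IsLimit.ofι' _ _ (fun {Z} x hx => ?_)
    dsimp at hx
    have h1 : (x ≫ b) ≫ p = 0 := by simpa using hx
    have h2 : h.exact.lift _ h1 ≫ i = _ := h.exact.lift_f _ h1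
    exact ⟨pullback.lift x (h.exact.lift _ h1) h2.symm, pullback.lift_fst _ _ _⟩
  obtain ⟨s, hs'⟩ := ext_of_extends h2 _ _ _ hs r
  refine ⟨s, ?_⟩
  rw [← hr, ← hs', ← ha, Category.assoc]

/-- maps factoring through a finite sum of copies of `T` -/
def FT (T : C) {X Y : C} (f : X ⟶ Y) : Prop :=
  ∃ (n : ℕ) (a : Fin n → (X ⟶ T)) (b : Fin n → (T ⟶ Y)), f = ∑ i, a i ≫ b i

lemma FT.add {T X Y : C} {f g : X ⟶ Y} (hf : FT T f) (hg : FT T g) : FT T (f + g) := by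
  obtain ⟨n, a, b, rfl⟩ := hf
  obtain ⟨m, c, d, rfl⟩ := hg
  refine ⟨n + m, Fin.append a c, Fin.append b d, ?_⟩
  rw [Fin.sum_univ_add]
  simp

lemma FT.comp {T X Y Z W : C} {f : X ⟶ Y} (hf : FT T f) (u : Z ⟶ X) (v : Y ⟶ W) :
    FT T (u ≫ f ≫ v) := by
  obtain ⟨n, a, b, rfl⟩ := hf
  refine ⟨n, fun i => u ≫ a i, fun i => b i ≫ v, ?_⟩
  simp [Preadditive.sum_comp, Preadditive.comp_sum]

lemma FT.zero {T X Y : C} : FT T (0 : X ⟶ Y) := ⟨0, Fin.elim0, Fin.elim0, by simp⟩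

lemma addSet_iff {T X : C} : X ∈ addSet ({T} : Set C) ↔ FT T (𝟙 X) := by
  constructor
  · rintro ⟨n, f, hf, i, r, hir⟩
    have hf' : f = fun _ => T := funext fun j => hf j
    subst hf'
    refine ⟨n, fun j => i ≫ biproduct.π _ j, fun j => biproduct.ι (fun _ : Fin n => T) j ≫ r, ?_⟩
    have := congrArg (fun x => i ≫ x ≫ r) (biproduct.total (f := fun _ : Fin n => T))
    simp only [Preadditive.sum_comp, Preadditive.comp_sum, Category.id_comp, hir] at this
    rw [← this]
    simp
  · rintro ⟨n, a, b, h⟩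
    refine ⟨n, fun _ => T, fun _ => rfl, biproduct.lift a, biproduct.desc b, ?_⟩
    rw [biproduct.lift_desc, ← h]

lemma ext_add_left {T X B : C} (h : Ext1Zero T B) (hX : FT T (𝟙 X)) : Ext1Zero X B := by
  obtain ⟨n, a, b, hab⟩ := hX
  intro E i p w hs
  choose s hs' using fun j => ext_lifts h i p w hs (b j)
  apply retr_of_section i p w hs (∑ j, a j ≫ s j)
  simp [Preadditive.sum_comp, hs', hab]

lemma ext_add_right {T X A : C} (h : Ext1Zero A T) (hX : FT T (𝟙 X)) : Ext1Zero A X := by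
  obtain ⟨n, a, b, hab⟩ := hX
  intro E i p w hs
  choose s hs' using fun j => ext_of_extends h i p w hs (a j)
  refine ⟨∑ j, s j ≫ b j, ?_⟩
  simp [Preadditive.comp_sum, hab, reassoc_of% hs']

lemma FT_of_summand {X T : C} (h : IsSummand X T) : FT T (𝟙 X) := by
  obtain ⟨i, r, h⟩ := h
  exact ⟨1, fun _ => i, fun _ => r, by simp [h]⟩

lemma FT_biproduct {T : C} {n : ℕ} : FT T (𝟙 (⨁ fun _ : Fin n => T)) :=
  ⟨n, fun j => biproduct.π _ j, fun j => biproduct.ι (fun _ : Fin n => T) j,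
    (biproduct.total (f := fun _ : Fin n => T)).symm⟩

/-- kernel of an approximation -/
lemma ext_kernel {K B U T : C} (j : K ⟶ B) (e : B ⟶ U) (w : j ≫ e = 0)
    (h : (ShortComplex.mk j e w).ShortExact) (hTB : Ext1Zero T B)
    (hl : ∀ t : T ⟶ U, ∃ t' : T ⟶ B, t' ≫ e = t) : Ext1Zero T K := by
  intro E i p wip hs
  have : Mono j := h.mono_f
  have : Epi p := hs.epi_g
  obtain ⟨s, hs'⟩ := ext_of_extends hTB i p wip hs j
  have h1 : i ≫ (s ≫ e) = 0 := by rw [← Category.assoc, hs', w]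
  obtain ⟨t', ht'⟩ := hl (hs.exact.desc _ h1)
  have h2 := hs.exact.g_desc _ h1
  dsimp at h2
  have h3 : (s - p ≫ t') ≫ e = 0 := by
    rw [Preadditive.sub_comp, Category.assoc, ht', h2, sub_self]
  refine ⟨h.exact.lift _ h3, ?_⟩
  have h4 := h.exact.lift_f _ h3
  dsimp at h4
  rw [← cancel_mono j, Category.assoc, h4]
  simp [hs', reassoc_of% wip]

lemma ses_kernel {A B : C} (f : A ⟶ B) [Epi f] :
    (ShortComplex.mk (kernel.ι f) f (kernel.condition f)).ShortExact :=
  ShortComplex.ShortExact.mk' (ShortComplex.exact_of_f_is_kernel _ (kernelIsKernel f))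
    inferInstance inferInstance

lemma ses_cokernel {A B : C} (f : A ⟶ B) [Mono f] :
    (ShortComplex.mk f (cokernel.π f) (cokernel.condition f)).ShortExact :=
  ShortComplex.ShortExact.mk' (ShortComplex.exact_of_g_is_cokernel _ (cokernelIsCokernel f))
    inferInstance inferInstance

lemma ses_biproduct {K G A : C} (i : K ⟶ G) (p : G ⟶ A) (w : i ≫ p = 0)
    (h : (ShortComplex.mk i p w).ShortExact) (n : ℕ) :
    (ShortComplex.mk (biproduct.map (fun _ : Fin n => i)) (biproduct.map (fun _ : Fin n => p))
      (by ext; simp [w])).ShortExact := by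
  have : Mono i := h.mono_f
  have : Epi p := h.epi_g
  have hm : Mono (biproduct.map (fun _ : Fin n => i)) := by
    refine ⟨fun {Z} u v huv => ?_⟩
    ext j
    have := congrArg (fun y => y ≫ biproduct.π (fun _ : Fin n => G) j) huv
    simp only [Category.assoc, biproduct.map_π] at this
    simpa only [← Category.assoc, cancel_mono] using this
  refine ShortComplex.ShortExact.mk' ?_ hm (by dsimp; infer_instance)
  apply ShortComplex.exact_of_f_is_kernel
  refine KernelFork.IsLimit.ofι' _ _ (fun {Z} x hx => ?_)
  dsimp at hx
  have h1 : ∀ j, (x ≫ biproduct.π (fun _ : Fin n => G) j) ≫ p = 0 := fun j => by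
    have := congrArg (fun y => y ≫ biproduct.π (fun _ : Fin n => A) j) hx
    simpa using this
  refine ⟨biproduct.lift fun j => h.exact.lift _ (h1 j), ?_⟩
  dsimp
  ext j
  have := h.exact.lift_f _ (h1 j)
  dsimp at this
  simp [this]

/-- universal extension -/
lemma univ_ext {R : Type*} [Field R] [Linear R C] {K G T M : C} (i : K ⟶ G) (p : G ⟶ T)
    (w : i ≫ p = 0) (h : (ShortComplex.mk i p w).ShortExact) [Projective G]
    [Module.Finite R (K ⟶ M)] (hT : Ext1Zero T T) :
    ∃ (n : ℕ) (E : C) (a : M ⟶ E) (b : E ⟶ ⨁ fun _ : Fin n => T) (w : a ≫ b = 0),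
      (ShortComplex.mk a b w).ShortExact ∧ Ext1Zero T E := by
  obtain ⟨n, φ, hφ⟩ := Module.Finite.exists_fin (R := R) (M := (K ⟶ M))
  obtain ⟨E, a, b, g, wab, hpo, hsq⟩ :=
    pushout_ses _ _ _ (ses_biproduct i p w h n) (biproduct.desc φ)
  refine ⟨n, E, a, b, wab, hpo, ?_⟩
  have hext : ∀ ψ : K ⟶ E, ∃ χ : G ⟶ E, i ≫ χ = ψ := by
    intro ψ
    have hTn : Ext1Zero T (⨁ fun _ : Fin n => T) := ext_add_right hT FT_biproduct
    obtain ⟨x, hx⟩ := ext_of_extends hTn i p w h (ψ ≫ b)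
    have : Epi b := hpo.epi_g
    have : Mono a := hpo.mono_f
    let y := Projective.factorThru x b
    have hy : y ≫ b = x := Projective.factorThru_comp x b
    have h1 : (ψ - i ≫ y) ≫ b = 0 := by simp [hy, hx]
    let z := hpo.exact.lift _ h1
    have hz : z ≫ a = ψ - i ≫ y := hpo.exact.lift_f _ h1
    have hzm : z ∈ Submodule.span R (Set.range φ) := by rw [hφ]; trivial
    obtain ⟨c, hc⟩ := (Submodule.mem_span_range_iff_exists_fun R).1 hzm
    refine ⟨y + biproduct.lift (fun j => c j • 𝟙 G) ≫ g, ?_⟩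
    have h2 : i ≫ biproduct.lift (fun j => c j • 𝟙 G) =
        biproduct.lift (fun j => c j • 𝟙 K) ≫ biproduct.map (fun _ : Fin n => i) := by
      ext; simp
    rw [Preadditive.comp_add, reassoc_of% h2, hsq, ← Category.assoc _ _ a, biproduct.lift_desc]
    have h3 : ∑ j, (c j • 𝟙 K) ≫ φ j = z := by rw [← hc]; simp
    rw [h3, hz]; abel
  intro F u v wuv huv
  have : Epi v := huv.epi_g
  have : Mono u := huv.mono_f
  have : Epi p := h.epi_g
  let q := Projective.factorThru p v
  have hq : q ≫ v = p := Projective.factorThru_comp p v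
  have h1 : (i ≫ q) ≫ v = 0 := by simp [hq, w]
  let z := huv.exact.lift _ h1
  have hz : z ≫ u = i ≫ q := huv.exact.lift_f _ h1
  obtain ⟨χ, hχ⟩ := hext z
  have h2 : i ≫ (q - χ ≫ u) = 0 := by simp [reassoc_of% hχ, hz]
  apply retr_of_section u v wuv huv (h.exact.desc _ h2)
  have h3 : p ≫ h.exact.desc _ h2 = _ := h.exact.g_desc _ h2
  rw [← cancel_epi p, reassoc_of% h3]
  simp [hq, wuv]

end Gen

section Reps

variable {k : Type} [Field k] {Q : FinQuiver}

instance : Fintype (Paths Q.V) := inferInstanceAs (Fintype Q.V)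

abbrev ev (k : Type) [Field k] {Q : FinQuiver} (v : Paths Q.V) : RepC k Q ⥤ ModuleCat.{0} k :=
  (evaluation (Paths Q.V) (ModuleCat.{0} k)).obj v

lemma ses_ev {S : ShortComplex (RepC k Q)} (h : S.ShortExact) (v : Paths Q.V) :
    (S.map (ev k v)).ShortExact := h.map_of_exact (ev k v)

lemma ses_of_ev {S : ShortComplex (RepC k Q)} (h : ∀ v, (S.map (ev k v)).ShortExact) :
    S.ShortExact := by
  have h1 : Mono S.f := by
    have : ∀ v, Mono (S.f.app v) := fun v => (h v).mono_f
    exact NatTrans.mono_of_mono_app _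
  have h2 : Epi S.g := by
    have : ∀ v, Epi (S.g.app v) := fun v => (h v).epi_g
    exact NatTrans.epi_of_epi_app _
  refine ShortComplex.ShortExact.mk' ?_ h1 h2
  rw [ShortComplex.exact_iff_isZero_homology]
  refine Functor.isZero _ fun v => ?_
  exact ((ShortComplex.exact_iff_isZero_homology _).1 (h v).exact).of_iso
    (S.mapHomologyIso (ev k v)).symm

/-- total dimension -/
def dd (M : RepC k Q) : ℕ := ∑ v : Paths Q.V, Module.finrank k (M.obj v)

lemma findim_iff (M : RepC k Q) : FinDim M ↔ ∀ v : Paths Q.V, Module.Finite k (M.obj v) := Iff.rfl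

lemma ev_inj {S : ShortComplex (RepC k Q)} (h : S.ShortExact) (v : Paths Q.V) :
    Function.Injective (S.f.app v).hom := (ses_ev h v).moduleCat_injective_f

lemma ev_surj {S : ShortComplex (RepC k Q)} (h : S.ShortExact) (v : Paths Q.V) :
    Function.Surjective (S.g.app v).hom := (ses_ev h v).moduleCat_surjective_g

lemma FinDim.of_mono {M N : RepC k Q} (h : FinDim N) (f : M ⟶ N) [Mono f] : FinDim M := by
  refine (findim_iff _).2 fun v => ?_
  have := (findim_iff _).1 h v
  exact Module.Finite.of_injective (f.app v).hom (ev_inj (ses_cokernel f) v)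

lemma FinDim.of_epi {M N : RepC k Q} (h : FinDim M) (f : M ⟶ N) [Epi f] : FinDim N := by
  refine (findim_iff _).2 fun v => ?_
  have := (findim_iff _).1 h v
  exact Module.Finite.of_surjective (f.app v).hom (ev_surj (ses_kernel f) v)

lemma dd_ses {S : ShortComplex (RepC k Q)} (h : S.ShortExact) (h1 : FinDim S.X₁)
    (h3 : FinDim S.X₃) : dd S.X₂ = dd S.X₁ + dd S.X₃ := by
  unfold dd
  rw [← Finset.sum_add_distrib]
  refine Finset.sum_congr rfl fun v _ => ?_
  have := h1 v
  have := h3 v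
  have i1 : Module.Finite k (S.map (ev k v)).X₁ := h1 v
  have i3 : Module.Finite k (S.map (ev k v)).X₃ := h3 v
  exact ModuleCat.free_shortExact_finrank_add (ses_ev h v) rfl rfl

lemma FinDim.ses {S : ShortComplex (RepC k Q)} (h : S.ShortExact) (h1 : FinDim S.X₁)
    (h3 : FinDim S.X₃) : FinDim S.X₂ := by
  refine (findim_iff _).2 fun v => ?_
  have := (findim_iff _).1 h1 v
  have := (findim_iff _).1 h3 v
  have hr := (ses_ev h v).exact.moduleCat_range_eq_ker
  have : IsNoetherian k (S.X₂.obj v) :=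
    isNoetherian_of_range_eq_ker (S.f.app v).hom (S.g.app v).hom hr
  infer_instance

lemma isZero_iff_obj (M : RepC k Q) : IsZero M ↔ ∀ v : Paths Q.V, IsZero (M.obj v) :=
  ⟨fun h v => h.obj v, fun h => Functor.isZero _ h⟩

lemma dd_zero {M : RepC k Q} (h : FinDim M) : dd M = 0 ↔ IsZero M := by
  rw [isZero_iff_obj]
  unfold dd
  simp only [Finset.sum_eq_zero_iff, Finset.mem_univ, true_imp_iff]
  refine forall_congr' fun v => ?_
  have := (findim_iff _).1 h v
  rw [Module.finrank_zero_iff, ModuleCat.isZero_iff_subsingleton]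

lemma zero_mid {S : ShortComplex (RepC k Q)} (h : S.ShortExact) (v : Paths Q.V)
    (h1 : IsZero (S.X₁.obj v)) (h3 : IsZero (S.X₃.obj v)) : IsZero (S.X₂.obj v) := by
  exact (ses_ev h v).exact.isZero_of_both_zeros (h1.eq_of_src _ _) (h3.eq_of_tgt _ _)

lemma zero_mono {M N : RepC k Q} (f : M ⟶ N) [Mono f] {v : Paths Q.V} (h : IsZero (N.obj v)) :
    IsZero (M.obj v) := IsZero.of_mono (f.app v) h

lemma zero_epi {M N : RepC k Q} (f : M ⟶ N) [Epi f] {v : Paths Q.V} (h : IsZero (M.obj v)) :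
    IsZero (N.obj v) := IsZero.of_epi (f.app v) h

lemma zero_FT {X T : RepC k Q} (hX : FT T (𝟙 X)) {v : Paths Q.V} (h : IsZero (T.obj v)) :
    IsZero (X.obj v) := by
  obtain ⟨n, a, b, hab⟩ := hX
  rw [IsZero.iff_id_eq_zero]
  have := congrArg (fun f => (ev k v).map f) hab
  simp only [Functor.map_sum, Functor.map_comp] at this
  refine this.trans (Finset.sum_eq_zero fun i _ => ?_)
  have h0 : (ev k v).map (a i) = 0 := h.eq_of_tgt _ _
  rw [h0, zero_comp]

lemma FinDim_FT {X T : RepC k Q} (hX : FT T (𝟙 X)) (h : FinDim T) : FinDim X := by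
  obtain ⟨n, a, b, hab⟩ := hX
  refine (findim_iff _).2 fun v => ?_
  have := (findim_iff _).1 h v
  refine Module.Finite.of_injective (LinearMap.pi fun i => ((a i).app v).hom :
    X.obj v →ₗ[k] (Fin n → T.obj v)) ?_
  rw [injective_iff_map_eq_zero]
  intro x hx
  have h1 := congrArg (fun f => ((ev k v).map f).hom x) hab
  simp only [Functor.map_sum, Functor.map_comp] at h1
  refine Eq.trans h1 ?_
  rw [ModuleCat.hom_sum, LinearMap.sum_apply]
  refine Finset.sum_eq_zero fun i _ => ?_
  have h2 : ((a i).app v).hom x = 0 := congrFun hx i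
  change ((b i).app v).hom (((a i).app v).hom x) = 0
  rw [h2, map_zero]

instance homFinite {M N : RepC k Q} [hM : Fact (FinDim M)] [hN : Fact (FinDim N)] :
    Module.Finite k (M ⟶ N) := by
  have i1 : ∀ v : Paths Q.V, Module.Finite k (M.obj v) := hM.1
  have i2 : ∀ v : Paths Q.V, Module.Finite k (N.obj v) := hN.1
  let F : (M ⟶ N) →ₗ[k] (∀ v : Paths Q.V, (M.obj v →ₗ[k] N.obj v)) :=
    { toFun := fun f v => (f.app v).hom
      map_add' := fun f g => rfl
      map_smul' := fun c f => rfl }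
  refine Module.Finite.of_injective F ?_
  intro f g hfg
  ext v : 2
  exact ModuleCat.hom_ext (congrFun hfg v)

lemma iso_of_epi_dd {M N : RepC k Q} (hM : FinDim M) (f : M ⟶ N) [Epi f] (h : dd M ≤ dd N) :
    IsIso f := by
  have hs := ses_kernel f
  have hK : FinDim (kernel f) := hM.of_mono (kernel.ι f)
  have h1 := dd_ses hs hK (hM.of_epi f)
  dsimp at h1
  have h2 : dd (kernel f) = 0 := by omega
  have h3 := (dd_zero hK).1 h2
  have : Mono f := Preadditive.mono_of_kernel_zero (h3.eq_of_src _ _)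
  exact isIso_of_mono_of_epi f

end Reps

section Local

/-- a finite-dimensional algebra with only trivial idempotents -/
lemma isUnit_or_of_idem {k R : Type*} [Field k] [Ring R] [Algebra k R] [Module.Finite k R]
    (hid : ∀ e : R, e * e = e → e = 0 ∨ e = 1) (f : R) : IsUnit f ∨ IsUnit (1 - f) := by
  obtain ⟨p, hp, hpf⟩ := Algebra.IsIntegral.isIntegral (R := k) f
  have hp0 : p ≠ 0 := hp.ne_zero
  obtain ⟨q, hq, hnd⟩ := Polynomial.exists_eq_pow_rootMultiplicity_mul_and_not_dvd p hp0 0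
  generalize p.rootMultiplicity 0 = m at hq
  simp only [map_zero, sub_zero] at hq hnd
  have hpf' : Polynomial.aeval f p = 0 := hpf
  have hz : Polynomial.aeval f (Polynomial.X ^ (m + 1) * q) = 0 := by
    rw [show Polynomial.X ^ (m + 1) * q = Polynomial.X * (Polynomial.X ^ m * q) by ring, ← hq,
      map_mul, hpf', mul_zero]
  obtain ⟨M, hM, hM0⟩ : ∃ M, M = m + 1 ∧ 0 < M := ⟨_, rfl, Nat.succ_pos _⟩
  rw [← hM] at hz
  clear hq
  clear hM
  clear m
  rename' M => m
  have hcop : IsCoprime (Polynomial.X ^ m) q :=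
    IsCoprime.pow_left ((Polynomial.irreducible_X.coprime_iff_not_dvd).2 hnd)
  obtain ⟨a, b, hab⟩ := hcop
  have hid1 : Polynomial.aeval f (a * Polynomial.X ^ m) *
      Polynomial.aeval f (a * Polynomial.X ^ m) = Polynomial.aeval f (a * Polynomial.X ^ m) := by
    have h1 : a * Polynomial.X ^ m * (a * Polynomial.X ^ m) =
      a * Polynomial.X ^ m - a * b * (Polynomial.X ^ m * q) := by
      linear_combination (a * Polynomial.X ^ m) * hab
    rw [← map_mul, h1, map_sub, map_mul _ (a * b), hz, mul_zero, sub_zero]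
  rcases hid _ hid1 with h | h
  · right
    have h2 : Polynomial.aeval f (b * q) = 1 := by
      have := congrArg (Polynomial.aeval f) hab
      rwa [map_add, h, zero_add, map_one] at this
    have h3 : f ^ m = 0 := by
      have h4 : Polynomial.aeval f (b * (Polynomial.X ^ m * q)) = 0 := by
        rw [map_mul, hz, mul_zero]
      have h5 : b * (Polynomial.X ^ m * q) = Polynomial.X ^ m * (b * q) := by ring
      rw [h5, map_mul, h2, mul_one] at h4
      simpa using h4
    exact IsNilpotent.isUnit_one_sub ⟨m, h3⟩
  · · left
      obtain ⟨m, rfl⟩ := Nat.exists_eq_succ_of_ne_zero hM0.ne'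
      refine isUnit_iff_exists.2 ⟨Polynomial.aeval f (a * Polynomial.X ^ m), ?_, ?_⟩
      · rw [← h]
        conv_lhs => rw [← Polynomial.aeval_X (R := k) f]
        simp only [Polynomial.aeval_X]
        rw [show a * Polynomial.X ^ m.succ = Polynomial.X * (a * Polynomial.X ^ m) by
          rw [pow_succ]; ring]
        simp
      · rw [← h]
        rw [show a * Polynomial.X ^ m.succ = (a * Polynomial.X ^ m) * Polynomial.X by
          rw [pow_succ]; ring]
        simp

end Local

section Local2

variable {C : Type*} [Category C] [Abelian C]

lemma indec_idem {U : C} (hU : Indec U) (e : U ⟶ U) (he : e ≫ e = e) : e = 0 ∨ e = 𝟙 U := by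
  obtain ⟨Y, i, r, h1, h2⟩ := IsIdempotentComplete.idempotents_split U e he
  obtain ⟨Z, j, s, h3, h4⟩ := IsIdempotentComplete.idempotents_split U (𝟙 U - e) (by simp [he])
  have hi : i ≫ e = i := by rw [← h2, reassoc_of% h1]
  have hj : j ≫ e = 0 := by
    have : j ≫ (𝟙 U - e) = j := by rw [← h4, reassoc_of% h3]
    simpa using this
  have hs : e ≫ s = 0 := by
    have : Mono j := mono_of_mono_fac h3
    rw [← cancel_mono j, Category.assoc, h4]; simp [he]
  have hr : e ≫ r = r := by rw [← h2, Category.assoc, h1, Category.comp_id]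
  let iso : U ≅ Y ⊞ Z :=
    { hom := biprod.lift r s
      inv := biprod.desc i j
      hom_inv_id := by rw [biprod.lift_desc, h2, h4]; abel
      inv_hom_id := by
        have e1 : i ≫ s = 0 := by rw [← hi, Category.assoc, hs, comp_zero]
        have e2 : j ≫ r = 0 := by rw [← hr, reassoc_of% hj, zero_comp]
        apply biprod.hom_ext' <;> apply biprod.hom_ext <;> simp [h1, h3, e1, e2] }
  rcases hU.2 Y Z iso with h | h
  · left; rw [← h2, h.eq_of_tgt r 0, zero_comp]
  · right
    have : 𝟙 U - e = 0 := by rw [← h4, h.eq_of_tgt s 0, zero_comp]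
    exact (sub_eq_zero.1 this).symm

lemma summand_of_FT {R : Type*} [Field R] [Linear R C] {U T : C} [Module.Finite R (U ⟶ U)]
    (hU : Indec U) (h : FT T (𝟙 U)) : IsSummand U T := by
  have : Module.Finite R (End U) := inferInstanceAs (Module.Finite R (U ⟶ U))
  have : Nontrivial (End U) := ⟨⟨0, 1, fun h => hU.1 ((IsZero.iff_id_eq_zero U).2 h.symm)⟩⟩
  have hloc : IsLocalRing (End U) := IsLocalRing.of_isUnit_or_isUnit_one_sub_self
    (fun f => isUnit_or_of_idem (k := R) (R := End U) (fun e he => indec_idem hU e he) f)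
  obtain ⟨n, a, b, hab⟩ := h
  let c : Fin n → End U := fun i => a i ≫ b i
  have key : ∀ (s : Finset (Fin n)) , IsUnit (∑ i ∈ s, (c i)) →
      ∃ i, IsUnit (c i) := by
    intro s
    induction s using Finset.induction_on with
    | empty => intro h; rw [Finset.sum_empty] at h; exact absurd h not_isUnit_zero
    | insert i s hi ih =>
      intro h
      rw [Finset.sum_insert hi] at h
      obtain ⟨u, hu⟩ := h
      have h1 : (↑u⁻¹ * (c i) : End U) + ↑u⁻¹ * (∑ i ∈ s, (c i)) = 1 := by
        rw [← mul_add, ← hu, Units.inv_mul]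
      rcases IsLocalRing.isUnit_or_isUnit_of_add_one h1 with h | h
      · exact ⟨i, (Units.isUnit_units_mul _ _).1 h⟩
      · exact ih ((Units.isUnit_units_mul _ _).1 h)
  obtain ⟨i, hi⟩ := key Finset.univ (by
    have : (∑ i, (c i)) = 1 := hab.symm
    rw [this]; exact isUnit_one)
  have : IsIso (a i ≫ b i) := (isUnit_iff_isIso _).1 hi
  exact ⟨a i, b i ≫ inv (a i ≫ b i), by rw [← Category.assoc, IsIso.hom_inv_id]⟩

end Local2

section Reps2

variable {k : Type} [Field k] {Q : FinQuiver}

/-- the simple representation at `w` -/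
def SS (k : Type) [Field k] {Q : FinQuiver} (w : Paths Q.V) : RepC k Q :=
  Paths.lift { obj := fun v : Q.V => ModuleCat.of k (PLift (v = w) → k), map := fun _ => 0 }

lemma SS_findim (w : Paths Q.V) : FinDim (SS k w) := by
  refine (findim_iff _).2 fun v => ?_
  change Module.Finite k (PLift (v = w) → k)
  infer_instance

lemma SS_dd (w : Paths Q.V) : dd (SS k w) = 1 := by
  classical
  have h : ∀ v : Paths Q.V, Module.finrank k ((SS k w).obj v) = if v = w then 1 else 0 := by
    intro v
    change Module.finrank k (PLift (v = w) → k) = _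
    rw [Module.finrank_fintype_fun_eq_card, Fintype.card_eq_nat_card]
    split_ifs with h
    · subst h; simp
    · have : IsEmpty (PLift (v = w)) := ⟨fun x => h x.down⟩
      simp
  unfold dd
  simp [h]

lemma SS_zero {v w : Paths Q.V} (h : v ≠ w) : IsZero ((SS k w).obj v) := by
  rw [ModuleCat.isZero_iff_subsingleton]
  change Subsingleton (PLift (v = w) → k)
  have : IsEmpty (PLift (v = w)) := ⟨fun x => h x.down⟩
  infer_instance

lemma SS_simple (w : Paths Q.V) : Simple (SS k w) := by
  refine ⟨fun {Y} f hf => ⟨?_, ?_⟩⟩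
  · intro h h0
    have : IsZero (SS k w) := by
      rw [IsZero.iff_id_eq_zero, ← IsIso.inv_hom_id f]
      simp [h0]
    have h1 := (dd_zero (SS_findim (k := k) w)).2 this
    rw [SS_dd] at h1
    omega
  · intro h0
    have hs := ses_cokernel f
    have hY : FinDim Y := (SS_findim w).of_mono f
    have hc : FinDim (cokernel f) := (SS_findim w).of_epi (cokernel.π f)
    have h1 := dd_ses hs hY hc
    dsimp at h1
    rw [SS_dd] at h1
    have h2 : dd Y ≠ 0 := fun h => h0 (((dd_zero hY).1 h).eq_of_src _ _)
    have h3 : IsZero (cokernel f) := (dd_zero hc).1 (by omega)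
    have : Epi f := Preadditive.epi_of_cokernel_zero (h3.eq_of_tgt _ _)
    exact isIso_of_mono_of_epi f

lemma exists_min_vertex (Z : Q.V → Prop) (h : ∃ v, Z v) :
    ∃ w, Z w ∧ ∀ (x : Q.V), (x ⟶ w) → ¬ Z x := by
  let r : Q.V → Q.V → Prop := fun x y => ∃ p : Quiver.Path x y, 0 < p.length
  have : IsTrans Q.V r := ⟨fun a b c ⟨p, hp⟩ ⟨q, hq⟩ => ⟨p.comp q, by simp; omega⟩⟩
  have : Std.Irrefl r := ⟨fun a ⟨p, hp⟩ => by rw [Q.acyclic a p] at hp; simp at hp⟩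
  have hwf : WellFounded r := Finite.wellFounded_of_trans_of_irrefl r
  obtain ⟨w, hw, hmin⟩ := hwf.has_min {v | Z v} h
  exact ⟨w, hw, fun x a hx => hmin x hx ⟨a.toPath, by simp⟩⟩

/-- build a morphism of representations vertexwise -/
def mkNat {M N : RepC k Q} (φ : ∀ v : Paths Q.V, M.obj v →ₗ[k] N.obj v)
    (h : ∀ (x y : Q.V) (a : x ⟶ y) (z : M.obj ((Paths.of Q.V).obj x)),
      φ ((Paths.of Q.V).obj y) ((M.map ((Paths.of Q.V).map a)).hom z) =
      (N.map ((Paths.of Q.V).map a)).hom (φ ((Paths.of Q.V).obj x) z)) : M ⟶ N :=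
  Paths.liftNatTrans (fun v => ModuleCat.ofHom (φ v)) (by
    intro x y a
    apply ModuleCat.hom_ext
    apply LinearMap.ext
    intro z
    exact h x y a z)

lemma mkNat_app {M N : RepC k Q} (φ : ∀ v : Paths Q.V, M.obj v →ₗ[k] N.obj v) (h)
    (v : Paths Q.V) : ((mkNat φ h).app v).hom = φ v := rfl

lemma exists_to_simple {M : RepC k Q} (hM : ¬ IsZero M) :
    ∃ (w : Paths Q.V) (f : M ⟶ SS k w), f ≠ 0 := by
  have h0 : ∃ v : Q.V, ¬ IsZero (M.obj v) := by
    by_contra h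
    push Not at h
    exact hM ((isZero_iff_obj M).2 h)
  obtain ⟨w, hw, hmin⟩ := exists_min_vertex (fun v : Q.V => ¬ IsZero (M.obj v)) h0
  rw [ModuleCat.isZero_iff_subsingleton, not_subsingleton_iff_nontrivial] at hw
  obtain ⟨m, hm⟩ := exists_ne (0 : M.obj w)
  have hex : ∀ v : Q.V, ∃ l : M.obj v →ₗ[k] k, ∀ e : v = w, l ≠ 0 := by
    intro v
    by_cases e : v = w
    · subst e
      obtain ⟨l, hl⟩ := Module.Projective.exists_dual_ne_zero k hm
      exact ⟨l, fun _ h => hl (by rw [h]; rfl)⟩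
    · exact ⟨0, fun h => absurd h e⟩
  choose l hl using hex
  refine ⟨w, mkNat (fun v =>
    (LinearMap.pi fun _ : PLift (v = w) => l v)) ?_, ?_⟩
  · intro x y a z
    have hz : (SS k (Q := Q) w).map ((Paths.of Q.V).map a) = 0 := by
      unfold SS
      exact Paths.lift_toPath _ _
    rw [hz]
    apply funext
    intro e
    have e' : y = w := e.down
    have h1 := hmin x (e' ▸ a)
    push Not at h1
    have : z = 0 := by
      rw [ModuleCat.isZero_iff_subsingleton] at h1
      exact Subsingleton.elim (α := M.obj x) _ _
    subst this
    change l y ((M.map ((Paths.of Q.V).map a)).hom 0) = 0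
    rw [map_zero]
    exact map_zero (l y)
  · intro h
    apply hl w rfl
    have h1 := congrArg (fun f => (f.app w).hom) h
    ext z
    exact congrFun (LinearMap.congr_fun h1 z) ⟨rfl⟩

lemma exists_sub_simple {M : RepC k Q} (hM : FinDim M) {j : Paths Q.V} (hj : ¬ IsZero (M.obj j)) :
    ∃ (N : RepC k Q) (i : N ⟶ M) (f : N ⟶ SS k j), Mono i ∧ Epi f := by
  have hex : ∃ n, ∃ (N : RepC k Q) (i : N ⟶ M), Mono i ∧ ¬ IsZero (N.obj j) ∧ dd N = n :=
    ⟨_, M, 𝟙 M, inferInstance, hj, rfl⟩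
  classical
  obtain ⟨N, i, hi, hN, hd⟩ := Nat.find_spec hex
  have hmin := fun m => Nat.find_min (m := m) hex
  rw [← hd] at hmin
  have hNz : ¬ IsZero N := fun h => hN ((isZero_iff_obj N).1 h j)
  obtain ⟨w, f, hf⟩ := exists_to_simple hNz
  have := SS_simple (k := k) w
  have hep : Epi f := epi_of_nonzero_to_simple hf
  have hNf : FinDim N := hM.of_mono i
  by_cases hw : w = j
  · subst hw; exact ⟨N, i, f, hi, hep⟩
  · exfalso
    have hs := ses_kernel f
    have h1 := dd_ses hs (hNf.of_mono (kernel.ι f)) (SS_findim w)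
    dsimp at h1
    rw [SS_dd] at h1
    refine hmin (dd (kernel f)) (by omega) ⟨kernel f, kernel.ι f ≫ i, inferInstance, ?_, rfl⟩
    intro hz
    exact hN (zero_mid hs j hz (SS_zero (Ne.symm hw)))

lemma homZero_iff {P : Q.V → RepC k Q} (hP : ∀ v, IsProjAt (P v) v) (j : Q.V) {M : RepC k Q}
    (hM : FinDim M) : HomZero (P j) M ↔ IsZero (M.obj ((Paths.of Q.V).obj j)) := by
  obtain ⟨hfd, hind, hproj, htop⟩ := hP j
  constructor
  · intro h
    by_contra hz
    obtain ⟨N, i, f, hi, hf⟩ := exists_sub_simple hM hz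
    have hS : ¬ IsZero ((SS k ((Paths.of Q.V).obj j)).obj ((Paths.of Q.V).obj j)) := by
      intro hz
      have : IsZero (SS k ((Paths.of Q.V).obj j)) := by
        rw [isZero_iff_obj]
        intro v
        by_cases e : v = (Paths.of Q.V).obj j
        · rw [e]; exact hz
        · exact SS_zero e
      have h1 := (dd_zero (SS_findim (k := k) _)).2 this
      rw [SS_dd] at h1
      omega
    obtain ⟨g, hg⟩ := (htop _ (SS_findim _) (SS_simple _)).2 hS
    have h1 := h (Projective.factorThru g f ≫ i)
    have h2 : Projective.factorThru g f = 0 := by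
      rw [← cancel_mono i, h1, zero_comp]
    apply hg
    rw [← Projective.factorThru_comp g f, h2, zero_comp]
  · intro hz f
    by_contra hf
    have hI : ¬ IsZero (Abelian.image f) := by
      intro h
      apply hf
      rw [← Abelian.image.fac f, h.eq_of_tgt (Abelian.factorThruImage f) 0, zero_comp]
    obtain ⟨w, g, hg⟩ := exists_to_simple hI
    have := SS_simple (k := k) w
    have hep : Epi g := epi_of_nonzero_to_simple hg
    have hne : Abelian.factorThruImage f ≫ g ≠ 0 := by
      intro h
      apply hg
      rw [← cancel_epi (Abelian.factorThruImage f), h, comp_zero]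
    apply (htop _ (SS_findim w) (SS_simple w)).1 ⟨_, hne⟩
    exact zero_epi g (zero_mono (Abelian.image.ι f) hz)

lemma suppLE_iff {M T : RepC k Q} (hM : FinDim M) (hT : FinDim T) :
    SuppLE M T ↔ ∀ v : Paths Q.V, IsZero (T.obj v) → IsZero (M.obj v) := by
  constructor
  · intro h v hv
    by_contra hz
    obtain ⟨N, i, f, hi, hf⟩ := exists_sub_simple hM hz
    obtain ⟨N', i', f', hi', hf'⟩ := h (SS k v) (SS_simple v) ⟨N, i, f, hi, hf⟩
    have h1 : IsZero ((SS k v).obj v) := zero_epi f' (zero_mono i' hv)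
    have : IsZero (SS k v) := by
      rw [isZero_iff_obj]
      intro u
      by_cases e : u = v
      · rw [e]; exact h1
      · exact SS_zero e
    have h1 := (dd_zero (SS_findim (k := k) _)).2 this
    rw [SS_dd] at h1
    omega
  · intro h S hS ⟨N, i, p, hi, hp⟩
    have hSz : ¬ IsZero S := Simple.not_isZero S
    have hSf : FinDim S := (hM.of_mono i).of_epi p
    obtain ⟨w, f, hf⟩ := exists_to_simple hSz
    have := SS_simple (k := k) w
    have hiso : IsIso f := isIso_of_hom_simple hf
    have hw : ¬ IsZero (T.obj w) := by
      intro hz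
      have h1 : IsZero ((SS k w).obj w) := zero_epi f (zero_epi p (zero_mono i (h w hz)))
      have : IsZero (SS k w) := by
        rw [isZero_iff_obj]
        intro u
        by_cases e : u = w
        · rw [e]; exact h1
        · exact SS_zero e
      exact hSz (this.of_iso (asIso f))
    obtain ⟨N', i', f', hi', hf'⟩ := exists_sub_simple hT hw
    exact ⟨N', i', f' ≫ inv f, hi', inferInstance⟩

end Reps2

section Hered

variable {k : Type} [Field k] {Q : FinQuiver}

/-- the extension attached to a cocycle -/
def EE (B U : RepC k Q) (φ : ∀ (x y : Q.V), (x ⟶ y) →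
    (U.obj ((Paths.of Q.V).obj x) →ₗ[k] B.obj ((Paths.of Q.V).obj y))) : RepC k Q :=
  Paths.lift
    { obj := fun v : Q.V =>
        ModuleCat.of k (B.obj ((Paths.of Q.V).obj v) × U.obj ((Paths.of Q.V).obj v))
      map := fun {x y} a => ModuleCat.ofHom (LinearMap.prod
        ((B.map ((Paths.of Q.V).map a)).hom ∘ₗ LinearMap.fst k _ _ + φ x y a ∘ₗ LinearMap.snd k _ _)
        ((U.map ((Paths.of Q.V).map a)).hom ∘ₗ LinearMap.snd k _ _)) }

lemma EE_map (B U : RepC k Q) (φ) (x y : Q.V) (a : x ⟶ y)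
    (b : B.obj ((Paths.of Q.V).obj x)) (u : U.obj ((Paths.of Q.V).obj x)) :
    ((EE B U φ).map ((Paths.of Q.V).map a)).hom
      ((b, u) : B.obj ((Paths.of Q.V).obj x) × U.obj ((Paths.of Q.V).obj x)) =
    (((B.map ((Paths.of Q.V).map a)).hom b + φ x y a u, (U.map ((Paths.of Q.V).map a)).hom u) :
      B.obj ((Paths.of Q.V).obj y) × U.obj ((Paths.of Q.V).obj y)) := by
  have h : (EE B U φ).map ((Paths.of Q.V).map a) = ModuleCat.ofHom (LinearMap.prod
        ((B.map ((Paths.of Q.V).map a)).hom ∘ₗ LinearMap.fst k _ _ + φ x y a ∘ₗ LinearMap.snd k _ _)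
        ((U.map ((Paths.of Q.V).map a)).hom ∘ₗ LinearMap.snd k _ _)) :=
    Paths.lift_toPath _ _
  rw [h]
  rfl

def EEinl (B U : RepC k Q) (φ) : B ⟶ EE B U φ :=
  mkNat (fun v => LinearMap.inl k (B.obj v) (U.obj v)) (by
    intro x y a z
    refine Eq.trans ?_ (EE_map B U φ x y a z 0).symm
    exact Prod.ext (by simp; rfl) (by simp; rfl))

def EEsnd (B U : RepC k Q) (φ) : EE B U φ ⟶ U :=
  mkNat (fun v => LinearMap.snd k (B.obj v) (U.obj v)) (by
    rintro x y a ⟨b, u⟩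
    exact congrArg Prod.snd (EE_map B U φ x y a b u))

lemma EE_w (B U : RepC k Q) (φ) : EEinl B U φ ≫ EEsnd B U φ = 0 := by
  apply NatTrans.ext
  funext v
  apply ModuleCat.hom_ext
  apply LinearMap.ext
  intro z
  rfl

lemma EE_ses (B U : RepC k Q) (φ) :
    (ShortComplex.mk (EEinl B U φ) (EEsnd B U φ) (EE_w B U φ)).ShortExact := by
  refine ses_of_ev fun v => ?_
  refine ShortComplex.ShortExact.mk' ?_ ?_ ?_
  · rw [ShortComplex.moduleCat_exact_iff]
    rintro ⟨b, u⟩ h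
    have h' : u = 0 := h
    subst h'
    exact ⟨b, rfl⟩
  · rw [ModuleCat.mono_iff_injective]
    exact LinearMap.inl_injective (R := k) (M := B.obj v) (M₂ := U.obj v)
  · rw [ModuleCat.epi_iff_surjective]
    exact LinearMap.snd_surjective (R := k) (M := B.obj v) (M₂ := U.obj v)

lemma ext_quot {U B K : RepC k Q} (h : Ext1Zero U B) (π : B ⟶ K) [Epi π] : Ext1Zero U K := by
  intro F i p w hs
  have hσ : ∀ v : Paths Q.V, ∃ σ : U.obj v →ₗ[k] F.obj v, ∀ u, (p.app v).hom (σ u) = u := by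
    intro v
    obtain ⟨σ, hσ⟩ := (p.app v).hom.exists_rightInverse_of_surjective
      (LinearMap.range_eq_top.2 (ev_surj hs v))
    exact ⟨σ, fun u => LinearMap.congr_fun hσ u⟩
  choose σ hσ using hσ
  have hl : ∀ v : Paths Q.V, ∃ l : F.obj v →ₗ[k] K.obj v, ∀ u, l ((i.app v).hom u) = u := by
    intro v
    obtain ⟨σ, hσ⟩ := (i.app v).hom.exists_leftInverse_of_injective
      (LinearMap.ker_eq_bot.2 (ev_inj hs v))
    exact ⟨σ, fun u => LinearMap.congr_fun hσ u⟩
  choose l hl using hl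
  have hρ : ∀ v : Paths Q.V, ∃ ρ : K.obj v →ₗ[k] B.obj v, ∀ u, (π.app v).hom (ρ u) = u := by
    intro v
    obtain ⟨σ, hσ⟩ := (π.app v).hom.exists_rightInverse_of_surjective
      (LinearMap.range_eq_top.2 (ev_surj (ses_kernel π) v))
    exact ⟨σ, fun u => LinearMap.congr_fun hσ u⟩
  choose ρ hρ using hρ
  have hex : ∀ (v : Paths Q.V) (z : F.obj v), (p.app v).hom z = 0 → (i.app v).hom (l v z) = z := by
    intro v z hz
    obtain ⟨t, ht⟩ := (ShortComplex.moduleCat_exact_iff _).1 (ses_ev hs v).exact z hz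
    have key : ∀ t : K.obj v, (i.app v).hom t = z → (i.app v).hom (l v z) = z := by
      intro t ht
      rw [← ht, hl]
    exact key t ht
  have nat : ∀ {M N : RepC k Q} (f : M ⟶ N) {x y : Paths Q.V} (a : x ⟶ y) (z : M.obj x),
      (f.app y).hom ((M.map a).hom z) = (N.map a).hom ((f.app x).hom z) := by
    intro M N f x y a z
    have := congrArg (fun g => g.hom z) (f.naturality a)
    simpa using this
  let φ : ∀ (x y : Q.V), (x ⟶ y) →
    (U.obj ((Paths.of Q.V).obj x) →ₗ[k] B.obj ((Paths.of Q.V).obj y)) := fun x y a =>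
      ρ _ ∘ₗ l _ ∘ₗ ((F.map ((Paths.of Q.V).map a)).hom ∘ₗ σ _ -
        σ _ ∘ₗ (U.map ((Paths.of Q.V).map a)).hom)
  have hφ : ∀ x y a u, (i.app _).hom ((π.app _).hom (φ x y a u)) =
      (F.map ((Paths.of Q.V).map a)).hom (σ _ u) - σ _ ((U.map ((Paths.of Q.V).map a)).hom u) := by
    intro x y a u
    change (i.app _).hom ((π.app _).hom (ρ _ (l _ _))) = _
    rw [hρ]
    apply hex
    rw [LinearMap.sub_apply, map_sub, LinearMap.comp_apply, LinearMap.comp_apply, nat, hσ, hσ,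
      sub_self]
  have key1 : ∀ (x y : Q.V) (a : x ⟶ y) (b : B.obj ((Paths.of Q.V).obj x))
      (u : U.obj ((Paths.of Q.V).obj x)),
      (i.app _).hom ((π.app _).hom ((B.map ((Paths.of Q.V).map a)).hom b + φ x y a u)) +
        σ _ ((U.map ((Paths.of Q.V).map a)).hom u) =
      (F.map ((Paths.of Q.V).map a)).hom ((i.app _).hom ((π.app _).hom b) + σ _ u) := by
    intro x y a b u
    rw [map_add, map_add, map_add, hφ, nat, nat]
    abel
  let e : EE B U φ ⟶ F := mkNat (fun v => LinearMap.coprod ((i.app v).hom ∘ₗ (π.app v).hom) (σ v))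
    (by
      rintro x y a ⟨b, u⟩
      refine Eq.trans (congrArg _ (EE_map B U φ x y a b u)) ?_
      exact key1 x y a b u)
  have key2 : ∀ (v : Paths Q.V) (b : B.obj v) (u : U.obj v),
      (p.app v).hom ((i.app v).hom ((π.app v).hom b) + σ v u) = u := by
    intro v b u
    rw [map_add, hσ]
    have : (p.app v).hom ((i.app v).hom ((π.app v).hom b)) = 0 := by
      have := congrArg (fun g => (g.app v).hom ((π.app v).hom b)) w
      simpa using this
    rw [this, zero_add]
  have he : e ≫ p = EEsnd B U φ := by
    apply NatTrans.ext
    funext v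
    apply ModuleCat.hom_ext
    apply LinearMap.ext
    rintro ⟨b, u⟩
    exact key2 v b u
  obtain ⟨r, hr⟩ := h _ _ _ _ (EE_ses B U φ)
  obtain ⟨s, hs'⟩ := section_of_retr _ _ _ (EE_ses B U φ) r hr
  exact retr_of_section i p w hs (s ≫ e) (by rw [Category.assoc, he, hs'])

end Hered

section Final

variable {k : Type} [Field k] {Q : FinQuiver}

lemma ses_biprod (A B : RepC k Q) :
    (ShortComplex.mk (biprod.inl : A ⟶ A ⊞ B) (biprod.snd : A ⊞ B ⟶ B) (by simp)).ShortExact :=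
  (ShortComplex.Splitting.ofHasBinaryBiproduct A B).shortExact

lemma enough {P : Q.V → RepC k Q} (hP : ∀ v, IsProjAt (P v) v) :
    ∀ (n : ℕ) (U : RepC k Q), FinDim U → dd U = n →
      ∃ (G : RepC k Q) (g : G ⟶ U), FinDim G ∧ Projective G ∧ Epi g := by
  intro n
  induction n using Nat.strong_induction_on with
  | _ n ih =>
    intro U hU hn
    by_cases hz : IsZero U
    · refine ⟨U, 𝟙 U, hU, ?_, inferInstance⟩
      exact ⟨fun f e _ => ⟨0, hz.eq_of_src _ _⟩⟩
    have h0 : ∃ v : Q.V, ¬ IsZero (U.obj ((Paths.of Q.V).obj v)) := by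
      by_contra h
      push Not at h
      exact hz ((isZero_iff_obj U).2 h)
    obtain ⟨j, hj⟩ := h0
    have h1 : ¬ HomZero (P j) U := fun h => hj ((homZero_iff hP j hU).1 h)
    unfold HomZero at h1
    push Not at h1
    obtain ⟨f, hf⟩ := h1
    have hI : ¬ IsZero (Abelian.image f) := by
      intro h
      apply hf
      rw [← Abelian.image.fac f, h.eq_of_tgt (Abelian.factorThruImage f) 0, zero_comp]
    have hIf : FinDim (Abelian.image f) := hU.of_mono (Abelian.image.ι f)
    have hs := ses_cokernel (Abelian.image.ι f)
    have hc : FinDim (cokernel (Abelian.image.ι f)) := hU.of_epi (cokernel.π _)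
    have hd := dd_ses hs hIf hc
    dsimp only at hd
    have h2 : dd (Abelian.image f) ≠ 0 := fun h => hI ((dd_zero hIf).1 h)
    obtain ⟨G, g, hG, hGp, hg⟩ := ih (dd (cokernel (Abelian.image.ι f))) (by omega) _ hc rfl
    have hPj := (hP j).2.2.1
    let g' := Projective.factorThru g (cokernel.π (Abelian.image.ι f))
    have hg' : g' ≫ cokernel.π (Abelian.image.ι f) = g := Projective.factorThru_comp _ _
    refine ⟨P j ⊞ G, biprod.desc f g', FinDim.ses (ses_biprod (P j) G) (hP j).1 hG,
      inferInstance, ?_⟩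
    refine Preadditive.epi_of_cancel_zero _ fun {Z} t ht => ?_
    have t1 : f ≫ t = 0 := by
      have := congrArg (fun x => biprod.inl ≫ x) ht
      simpa using this
    have t2 : g' ≫ t = 0 := by
      have := congrArg (fun x => biprod.inr ≫ x) ht
      simpa using this
    have t3 : Abelian.image.ι f ≫ t = 0 := by
      rw [← cancel_epi (Abelian.factorThruImage f), comp_zero, ← Category.assoc,
        Abelian.image.fac, t1]
    have t4 : t = cokernel.π (Abelian.image.ι f) ≫ cokernel.desc _ t t3 := by simp
    have t5 : cokernel.desc _ t t3 = 0 := by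
      rw [← cancel_epi g, comp_zero, ← hg', Category.assoc, ← t4, t2]
    rw [t4, t5, comp_zero]

/-- the ambient subcategory -/
abbrev AA (T : RepC k Q) : Set (RepC k Q) := { M : RepC k Q | FinDim M ∧ SuppLE M T }

lemma mem_AA {T M : RepC k Q} (hT : FinDim T) (hM : FinDim M) :
    M ∈ AA T ↔ ∀ v : Paths Q.V, IsZero (T.obj v) → IsZero (M.obj v) :=
  ⟨fun h => (suppLE_iff hM hT).1 h.2, fun h => ⟨hM, (suppLE_iff hM hT).2 h⟩⟩

lemma AA_mono {T M N : RepC k Q} (hT : FinDim T) (hN : N ∈ AA T) (f : M ⟶ N) [Mono f] :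
    M ∈ AA T :=
  (mem_AA hT (hN.1.of_mono f)).2 fun v hv => zero_mono f ((mem_AA hT hN.1).1 hN v hv)

lemma AA_ses {T : RepC k Q} (hT : FinDim T) {S : ShortComplex (RepC k Q)} (h : S.ShortExact)
    (h1 : S.X₁ ∈ AA T) (h3 : S.X₃ ∈ AA T) : S.X₂ ∈ AA T :=
  (mem_AA hT (FinDim.ses h h1.1 h3.1)).2 fun v hv =>
    zero_mid h v ((mem_AA hT h1.1).1 h1 v hv) ((mem_AA hT h3.1).1 h3 v hv)

lemma AA_FT {T X : RepC k Q} (hT : FinDim T) (hX : FT T (𝟙 X)) : X ∈ AA T :=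
  (mem_AA hT (FinDim_FT hX hT)).2 fun _ hv => zero_FT hX hv

lemma AA_self {T : RepC k Q} (hT : FinDim T) : T ∈ AA T := ⟨hT, fun _ _ h => h⟩

lemma exists_splitProj {P : Q.V → RepC k Q} (hP : ∀ v, IsProjAt (P v) v) {T U : RepC k Q}
    (hT : FinDim T) (hU : U ∈ AA T) :
    ∃ (G : RepC k Q) (c : G ⟶ U), SplitProjIn (AA T) G ∧ Epi c := by
  obtain ⟨G, g, hG, hGp, hg⟩ := enough hP _ U hU.1 rfl
  have hbd : ∀ (G' : RepC k Q) (q : G ⟶ G'), Epi q → dd G' ≤ dd G := by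
    intro G' q hq
    have := dd_ses (ses_kernel q) (hG.of_mono (kernel.ι q)) (hG.of_epi q)
    dsimp only at this
    omega
  have hex : ∃ n, ∃ (G' : RepC k Q) (q : G ⟶ G') (c : G' ⟶ U),
      Epi q ∧ G' ∈ AA T ∧ q ≫ c = g ∧ dd G' + n = dd G :=
    ⟨dd G - dd U, U, g, 𝟙 U, hg, hU, Category.comp_id g, by have := hbd U g hg; omega⟩
  classical
  obtain ⟨G', q, c, hq, hG', hc, hd⟩ := Nat.find_spec hex
  have hmin := fun m => Nat.find_min (m := m) hex
  have hmax : ∀ (X : RepC k Q) (q' : G ⟶ X) (c' : X ⟶ U), Epi q' → X ∈ AA T → q' ≫ c' = g →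
      dd X ≤ dd G' := by
    intro X q' c' h1 h2 h3
    have h4 := hbd X q' h1
    by_contra hlt
    push Not at hlt
    exact hmin (dd G - dd X) (by omega) ⟨X, q', c', h1, h2, h3, by omega⟩
  refine ⟨G', c, ⟨hG', ?_⟩, ?_⟩
  · intro X hX p hp
    let q' := Projective.factorThru q p
    have hq' : q' ≫ p = q := Projective.factorThru_comp _ _
    have hfac : Abelian.factorThruImage q' ≫ (Abelian.image.ι q' ≫ p) = q := by
      rw [← Category.assoc, Abelian.image.fac, hq']
    have hI : Abelian.image q' ∈ AA T := AA_mono hT hX (Abelian.image.ι q')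
    have hep : Epi (Abelian.image.ι q' ≫ p) := by
      have : Epi (Abelian.factorThruImage q' ≫ (Abelian.image.ι q' ≫ p)) := by rw [hfac]; exact hq
      exact epi_of_epi (Abelian.factorThruImage q') _
    have hle := hmax (Abelian.image q') (Abelian.factorThruImage q') ((Abelian.image.ι q' ≫ p) ≫ c)
      inferInstance hI (by rw [← Category.assoc, hfac, hc])
    have := iso_of_epi_dd hI.1 (Abelian.image.ι q' ≫ p) hle
    exact ⟨inv (Abelian.image.ι q' ≫ p) ≫ Abelian.image.ι q', by
      rw [Category.assoc, IsIso.inv_hom_id]⟩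
  · have : Epi (q ≫ c) := by rw [hc]; exact hg
    exact epi_of_epi q c

lemma gen_of_ext {P : Q.V → RepC k Q} (hP : ∀ v, IsProjAt (P v) v) {T U : RepC k Q}
    (hT : FinDim T) (hst : IsSupportTilting T) (hU : U ∈ AA T) (hext : Ext1Zero T U) :
    ∃ (T' : RepC k Q) (t : T' ⟶ U), FT T (𝟙 T') ∧ Epi t := by
  obtain ⟨G, c, hG, hc⟩ := exists_splitProj hP hT hU
  obtain ⟨T', T'', h', h'', i, p, w, hs⟩ := hst.2.2.2 G hG
  obtain ⟨t, ht⟩ := ext_of_extends (ext_add_left hext (addSet_iff.1 h'')) i p w hs c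
  refine ⟨T', t, addSet_iff.1 h', ?_⟩
  have : Epi (i ≫ t) := by rw [ht]; exact hc
  exact epi_of_epi i t

lemma summand_of_ext {P : Q.V → RepC k Q} (hP : ∀ v, IsProjAt (P v) v) {T U : RepC k Q}
    (hT : FinDim T) (hst : IsSupportTilting T) (hU : U ∈ AA T) (hind : Indec U)
    (h1 : Ext1Zero T U) (h2 : Ext1Zero U T) : IsSummand U T := by
  have hTF : Fact (FinDim T) := ⟨hT⟩
  have hUF : Fact (FinDim U) := ⟨hU.1⟩
  obtain ⟨n, s, hs⟩ := Module.Finite.exists_fin (R := k) (M := (T ⟶ U))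
  let e : (⨁ fun _ : Fin n => T) ⟶ U := biproduct.desc s
  have hl : ∀ t : T ⟶ U, ∃ t' : T ⟶ (⨁ fun _ : Fin n => T), t' ≫ e = t := by
    intro t
    have ht : t ∈ Submodule.span k (Set.range s) := by rw [hs]; trivial
    obtain ⟨c, hc⟩ := (Submodule.mem_span_range_iff_exists_fun k).1 ht
    refine ⟨biproduct.lift fun i => c i • 𝟙 T, ?_⟩
    rw [← hc, biproduct.lift_desc]
    simp
  obtain ⟨T', t, hT', ht⟩ := gen_of_ext hP hT hst hU h1
  have hepi : Epi e := by
    obtain ⟨m, a, b, hab⟩ := hT'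
    choose d hd using fun i => hl (b i ≫ t)
    have : (∑ i, a i ≫ d i) ≫ e = t := by
      rw [Preadditive.sum_comp]
      simp only [Category.assoc, hd]
      have := congrArg (fun x => x ≫ t) hab
      simp only [Preadditive.sum_comp, Category.assoc, Category.id_comp] at this
      exact this.symm
    have : Epi ((∑ i, a i ≫ d i) ≫ e) := by rw [this]; exact ht
    exact epi_of_epi (∑ i, a i ≫ d i) e
  have hses := ses_kernel e
  have hK : kernel e ∈ AA T := AA_mono hT (AA_FT hT FT_biproduct) (kernel.ι e)
  have hTK : Ext1Zero T (kernel e) :=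
    ext_kernel _ _ _ hses (ext_add_right hst.1 FT_biproduct) hl
  obtain ⟨T₂, t₂, hT₂, ht₂⟩ := gen_of_ext hP hT hst hK hTK
  have hUK : Ext1Zero U (kernel e) := ext_quot (ext_add_right h2 hT₂) t₂
  obtain ⟨r, hr⟩ := hUK _ _ _ _ hses
  obtain ⟨σ, hσ⟩ := section_of_retr _ _ _ hses r hr
  have hF : FT T (𝟙 U) := by
    have := (FT_biproduct (T := T) (n := n)).comp σ e
    rwa [Category.id_comp, hσ] at this
  exact summand_of_FT (R := k) hind hF

lemma FT_of_cluster {P : Q.V → RepC k Q} {T : RepC k Q}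
    (hsum : ∀ U : RepC k Q, FinDim U → Indec U → Ext1Zero T U → Ext1Zero U T → U ∈ AA T →
      IsSummand U T) (hT : FinDim T) :
    ∀ (n : ℕ) (F : RepC k Q), dd F = n → F ∈ AA T → Ext1Zero T F → Ext1Zero F T → FT T (𝟙 F) := by
  intro n
  induction n using Nat.strong_induction_on with
  | _ n ih =>
    intro F hn hF h1 h2
    by_cases hz : IsZero F
    · rw [hz.eq_of_src (𝟙 F) 0]; exact FT.zero
    by_cases hi : Indec F
    · exact FT_of_summand (hsum F hF.1 hi h1 h2 hF)
    unfold Indec at hi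
    push Not at hi
    obtain ⟨A, B, e, hA, hB⟩ := hi hz
    have sA : IsSummand A F := ⟨biprod.inl ≫ e.inv, e.hom ≫ biprod.fst, by simp⟩
    have sB : IsSummand B F := ⟨biprod.inr ≫ e.inv, e.hom ≫ biprod.snd, by simp⟩
    have mem : ∀ Y, IsSummand Y F → Y ∈ AA T := by
      rintro Y ⟨i, r, hir⟩
      have : Mono i := (SplitMono.mk r hir).mono
      exact AA_mono hT hF i
    have mA := mem A sA
    have mB := mem B sB
    have hd : dd F = dd A + dd B := by
      have w : (biprod.inl ≫ e.inv) ≫ (e.hom ≫ (biprod.snd : A ⊞ B ⟶ B)) = 0 := by simp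
      have hs : (ShortComplex.mk (biprod.inl ≫ e.inv : A ⟶ F)
          (e.hom ≫ (biprod.snd : A ⊞ B ⟶ B)) w).ShortExact :=
        ShortComplex.shortExact_of_iso (S₁ := ShortComplex.mk (biprod.inl : A ⟶ A ⊞ B)
          (biprod.snd : A ⊞ B ⟶ B) (by simp)) (ShortComplex.isoMk (Iso.refl A) e.symm (Iso.refl B)
          (by simp) (by simp)) (ses_biprod A B)
      exact dd_ses hs mA.1 mB.1
    have dA : dd A ≠ 0 := fun h => hA ((dd_zero mA.1).1 h)
    have dB : dd B ≠ 0 := fun h => hB ((dd_zero mB.1).1 h)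
    have fA := ih (dd A) (by omega) A rfl mA (ext_add_right h1 (FT_of_summand sA))
      (ext_add_left h2 (FT_of_summand sA))
    have fB := ih (dd B) (by omega) B rfl mB (ext_add_right h1 (FT_of_summand sB))
      (ext_add_left h2 (FT_of_summand sB))
    have := ((fA.comp biprod.fst biprod.inl).add (fB.comp biprod.snd biprod.inr)).comp e.hom e.inv
    simpa [biprod.total] using this

lemma st_of_cluster {P : Q.V → RepC k Q} (hP : ∀ v, IsProjAt (P v) v) (X : CCObj k Q)
    (hT : FinDim X.r) (hX : IsClusterTilting P X) : IsSupportTilting X.r := by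
  obtain ⟨hself, hsum, hsh⟩ := hX
  have hTT : Ext1Zero X.r X.r := hself.1
  refine ⟨hTT, AA_self hT, hTT, ?_⟩
  intro M hM
  have hMA : M ∈ AA X.r := hM.1
  have hsum' : ∀ U : RepC k Q, FinDim U → Indec U → Ext1Zero X.r U → Ext1Zero U X.r →
      U ∈ AA X.r → IsSummand U X.r := by
    intro U hU hi h1 h2 hA
    refine hsum U hU hi h1 h2 fun i hi => ?_
    rw [homZero_iff hP i hU]
    exact (mem_AA hT hU).1 hA _ ((homZero_iff hP i hT).1 (hself.2.2.1 i hi))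
  have hMT : Ext1Zero M X.r := by
    intro E i p w hs
    have hE : E ∈ AA X.r := AA_ses hT hs (AA_self hT) hMA
    obtain ⟨s, hs'⟩ := hM.2 E hE p hs.epi_g
    exact retr_of_section i p w hs s hs'
  obtain ⟨G, g, hG, hGp, hg⟩ := enough hP _ X.r hT rfl
  have f1 : Fact (FinDim (kernel g)) := ⟨hG.of_mono (kernel.ι g)⟩
  have f2 : Fact (FinDim M) := ⟨hMA.1⟩
  obtain ⟨n, E, a, b, w, hs, hTE⟩ := univ_ext (R := k) (M := M) _ _ _ (ses_kernel g) hTT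
  have hET : Ext1Zero E X.r := ext_middle a b w hs hMT (ext_add_left hTT FT_biproduct)
  have hE : E ∈ AA X.r := AA_ses hT hs hMA (AA_FT hT FT_biproduct)
  have hF := FT_of_cluster (P := P) hsum' hT _ E rfl hE hTE hET
  exact ⟨E, _, addSet_iff.2 hF, addSet_iff.2 FT_biproduct, a, b, w, hs⟩

end Final

end Helpers

section Statement11

/-- If `T` is a cluster tilting object in the cluster category
`CC_Q`, then the maximal direct summand `T.r` of `T` lying in `rep Q` is a support
tilting module.  Conversely, every support tilting module `V0` in `rep Q` extends to a
cluster tilting object of `CC_Q` by adding shifted projectives in exactly one way,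
namely by adding the shifted projectives `P_j[1]` for the vertices `j` not in the
support of `V0`. -/
theorem statement11 (k : Type) [Field k] [IsAlgClosed k] (Q : FinQuiver)
    (P : Q.V → RepC k Q) (hP : ∀ v, IsProjAt (P v) v)
    (hPall : ∀ X : RepC k Q, FinDim X → Indec X → Projective X →
      ∃ v, Nonempty (X ≅ P v)) :
    (∀ X : CCObj k Q, FinDim X.r → IsClusterTilting P X → IsSupportTilting X.r) ∧
    (∀ V0 : RepC k Q, FinDim V0 → IsSupportTilting V0 →
      IsClusterTilting P ⟨V0, { j : Q.V | IsZero (V0.obj ((Paths.of Q.V).obj j)) }⟩ ∧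
      ∀ J : Set Q.V, IsClusterTilting P ⟨V0, J⟩ →
        J = { j : Q.V | IsZero (V0.obj ((Paths.of Q.V).obj j)) }) := by
  refine ⟨fun X hX h => st_of_cluster hP X hX h, fun V0 hV hst => ⟨⟨⟨hst.1, hst.1, ?_, ?_⟩, ?_, ?_⟩, ?_⟩⟩
  · intro i hi
    exact (homZero_iff hP i hV).2 hi
  · intro i hi
    exact (homZero_iff hP i hV).2 hi
  · intro U hU hind h1 h2 h3
    refine summand_of_ext hP hV hst ((mem_AA hV hU).2 fun v hv => ?_) hind h1 h2
    exact (homZero_iff hP v hU).1 (h3 v hv)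
  · intro j hj
    exact (homZero_iff hP j hV).1 hj
  · intro J hJ
    ext j
    exact ⟨fun h => (homZero_iff hP j hV).1 (hJ.1.2.2.1 j h),
      fun h => hJ.2.2 j ((homZero_iff hP j hV).2 h)⟩

end Statement11
end NCPaper
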